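/- Let A be the 5×5 reciprocal matrix with rows (1, 1, a_13, a_14, 1), (1, 1, 1, a_24, 1), (1/a_13, 1, 1, 1, 1), (1/a_14, 1/a_24, 1, 1, 1), (1, 1, 1, 1, 1), where a_13, a_24 > 0 and a_14 ≥ 1. Then C(A) ⊆ E(A) if and only if neither (1 < a_24 < a_14 < a_13) nor (a_24 < 1 < a_13 < a_14) holds. -/

import Mathlib

open Matrix

/-- An `n × n` real matrix is *reciprocal* if all its entries are positive and
`A j i = 1 / A i j` for all `i, j`. -/
def IsReciprocal {n : ℕ} (A : Matrix (Fin n) (Fin n) ℝ) : Prop :=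
  (∀ i j, 0 < A i j) ∧ ∀ i j, A j i = 1 / A i j

/-- A positive vector `w` is *efficient* for `A` if every positive vector `v` whose
associated consistent matrix approximates `A` at least as well entrywise is
proportional to `w`. -/
def IsEfficient {n : ℕ} (A : Matrix (Fin n) (Fin n) ℝ) (w : Fin n → ℝ) : Prop :=
  (∀ i, 0 < w i) ∧
    ∀ v : Fin n → ℝ, (∀ i, 0 < v i) →
      (∀ i j, |A i j - v i / v j| ≤ |A i j - w i / w j|) → ∃ c : ℝ, v = c • w

/-- The set of efficient vectors for `A`. -/
def EffSet {n : ℕ} (A : Matrix (Fin n) (Fin n) ℝ) : Set (Fin n → ℝ) :=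
  {w | IsEfficient A w}

/-- The cone generated by the columns of `A`: nonzero vectors of the form `A · u`
with `u` entrywise nonnegative. -/
def ConeCols {n : ℕ} (A : Matrix (Fin n) (Fin n) ℝ) : Set (Fin n → ℝ) :=
  {w | w ≠ 0 ∧ ∃ u : Fin n → ℝ, (∀ i, 0 ≤ u i) ∧ w = A.mulVec u}

/-- A *monomial* matrix: the product of a permutation matrix and a diagonal matrix
with positive diagonal entries. -/
def IsMonomial {n : ℕ} (S : Matrix (Fin n) (Fin n) ℝ) : Prop :=
  ∃ (σ : Equiv.Perm (Fin n)) (d : Fin n → ℝ), (∀ i, 0 < d i) ∧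
    S = σ.permMatrix ℝ * Matrix.diagonal d

lemma ratio_le_of_edge {p x y v1 v2 : ℝ} (hx : 0 < x) (hy : 0 < y) (h2 : 0 < v2)
    (h : |p - v1 / v2| ≤ |p - x / y|) (hp : p * y ≤ x) : v1 / x ≤ v2 / y := by
  have hp' : p ≤ x / y := by rwa [le_div_iff₀ hy]
  rw [abs_of_nonpos (by linarith : p - x / y ≤ 0)] at h
  have h3 := neg_le_abs (p - v1 / v2)
  have h4 : v1 / v2 ≤ x / y := by linarith
  rw [div_le_div_iff₀ h2 hy] at h4
  rw [div_le_div_iff₀ hx hy]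
  linarith

/-- A vertex without outgoing edges prevents efficiency. -/
lemma not_efficient_of_sink {n : ℕ} (A : Matrix (Fin n) (Fin n) ℝ) (w : Fin n → ℝ)
    (k l : Fin n) (hlk : l ≠ k) (hA : ∀ j, 0 < A j k) (hrec : ∀ j, A k j = 1 / A j k)
    (hw : ∀ i, 0 < w i) (x : ℝ) (hx : w k < x) (hj : ∀ j, j ≠ k → A j k * x ≤ w j) :
    ¬ IsEfficient A w := by
  rintro ⟨-, h⟩
  have hx0 : 0 < x := (hw k).trans hx
  obtain ⟨d, hd⟩ := h (Function.update w k x) (by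
      intro i
      by_cases hi : i = k
      · subst hi; simpa using hx0
      · simpa [Function.update_of_ne hi] using hw i) (by
      intro i j
      by_cases hi : i = k <;> by_cases hjk : j = k
      · subst hi; subst hjk
        simp [hx0.ne', (hw j).ne']
      · subst hi
        simp only [Function.update_self, Function.update_of_ne hjk]
        have h1 : w i / w j ≤ x / w j := by
          have := (hw j).le
          gcongr
        have h2 : x / w j ≤ A i j := by
          rw [hrec j, div_le_div_iff₀ (hw j) (hA j)]
          linarith [hj j hjk]
        rw [abs_of_nonneg (by linarith), abs_of_nonneg (by linarith)]
        linarith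
      · subst hjk
        simp only [Function.update_self, Function.update_of_ne hi]
        have h1 : w i / x ≤ w i / w j := by
          have := (hw i).le
          have := hw j
          gcongr
        have h2 : A i j ≤ w i / x := by
          rw [le_div_iff₀ hx0]
          exact hj i hi
        rw [abs_of_nonpos (by linarith), abs_of_nonpos (by linarith)]
        linarith
      · simp only [Function.update_of_ne hjk, Function.update_of_ne hi]
        exact le_refl _)
  have e1 := congrFun hd l
  have e2 := congrFun hd k
  simp only [Function.update_self, Function.update_of_ne hlk, Pi.smul_apply, smul_eq_mul] at e1 e2
  have : d = 1 := by
    have := hw l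
    have h3 : (d - 1) * w l = 0 := by linarith
    rcases mul_eq_zero.mp h3 with h4 | h4 <;> linarith
  subst this
  linarith

/-- Strong connectivity of the digraph in all admissible cases. -/
lemma core (a b c x y z t s r1 r2 r3 r4 r5 : ℝ) (ha : 0 < a) (hc : 0 < c) (hb : 1 ≤ b)
    (hx : 0 ≤ x) (hy : 0 ≤ y) (hz : 0 ≤ z) (ht : 0 ≤ t) (hs : 0 ≤ s)
    (e15 : 0 ≤ (a-1)*z+(b-1)*t → r1 ≤ r5)
    (e25 : 0 ≤ (c-1)*t → r2 ≤ r5) (e52 : (c-1)*t ≤ 0 → r5 ≤ r2)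
    (e53 : 0 ≤ (a-1)*(b*x) → r5 ≤ r3) (e35 : (a-1)*(b*x) ≤ 0 → r3 ≤ r5)
    (e54 : 0 ≤ (b-1)*(a*x)+(c-1)*y → r5 ≤ r4)
    (e12 : 0 ≤ (a-1)*z+(b-c)*t → r1 ≤ r2) (e21 : (a-1)*z+(b-c)*t ≤ 0 → r2 ≤ r1)
    (e32 : (a-1)*(b*x)+(c-1)*t ≤ 0 → r3 ≤ r2)
    (e34 : 0 ≤ (b-a)*x+(c-1)*y → r3 ≤ r4) (e43 : (b-a)*x+(c-1)*y ≤ 0 → r4 ≤ r3)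
    (e13 : 0 ≤ (1-a)*(c*y+s)+(b-a)*t → r1 ≤ r3) (e31 : (1-a)*(c*y+s)+(b-a)*t ≤ 0 → r3 ≤ r1)
    (e41 : (c-b)*y+(a-b)*z+(1-b)*s ≤ 0 → r4 ≤ r1)
    (e24 : 0 ≤ (b-c)*(a*x)+(1-c)*(z+s) → r2 ≤ r4) (e42 : (b-c)*(a*x)+(1-c)*(z+s) ≤ 0 → r4 ≤ r2)
    (hX : ¬ (1 < c ∧ c < b ∧ b < a)) (hY : ¬ (c < 1 ∧ 1 < a ∧ a < b)) :
    r2 = r1 ∧ r3 = r1 ∧ r4 = r1 ∧ r5 = r1 := by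
  have hbx : 0 ≤ b * x := by positivity
  have hax : 0 ≤ a * x := by positivity
  have hcys : 0 ≤ c * y + s := by positivity
  have hzs : 0 ≤ z + s := by positivity
  have P : ∀ {p q : ℝ}, 0 ≤ p → 0 ≤ q → 0 ≤ p * q := fun h1 h2 => mul_nonneg h1 h2
  have N : ∀ {p q : ℝ}, p ≤ 0 → 0 ≤ q → p * q ≤ 0 := fun h1 h2 =>
    mul_nonpos_of_nonpos_of_nonneg h1 h2
  have PP : ∀ {p q : ℝ}, 0 ≤ p → 0 ≤ q → 0 ≤ p + q := fun h1 h2 => add_nonneg h1 h2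
  have NN : ∀ {p q : ℝ}, p ≤ 0 → q ≤ 0 → p + q ≤ 0 := fun h1 h2 => add_nonpos h1 h2
  rcases le_total a 1 with h1 | h1 <;> rcases le_total c 1 with h2 | h2
  · -- a ≤ 1, c ≤ 1
    have f1 := e13 (PP (P (by linarith) hcys) (P (by linarith) ht))
    have f2 := e35 (N (by linarith) hbx)
    have f3 := e52 (N (by linarith) ht)
    have f4 := e24 (PP (P (by linarith) hax) (P (by linarith) hzs))
    have f5 := e41 (NN (NN (N (by linarith) hy) (N (by linarith) hz)) (N (by linarith) hs))
    refine ⟨?_, ?_, ?_, ?_⟩ <;> linarith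
  · -- a ≤ 1 ≤ c
    have f1 := e13 (PP (P (by linarith) hcys) (P (by linarith) ht))
    have f2 := e35 (N (by linarith) hbx)
    have f3 := e54 (PP (P (by linarith) hax) (P (by linarith) hy))
    rcases le_total b c with h3 | h3
    · have f4 := e42 (NN (N (by linarith) hax) (N (by linarith) hzs))
      have f5 := e21 (NN (N (by linarith) hz) (N (by linarith) ht))
      refine ⟨?_, ?_, ?_, ?_⟩ <;> linarith
    · have f4 := e41 (NN (NN (N (by linarith) hy) (N (by linarith) hz)) (N (by linarith) hs))
      have f5 := e25 (P (by linarith) ht)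
      have f6 : r1 ≤ r2 := by
        by_contra hcon
        have g1 : (a-1)*z+(b-c)*t < 0 := by
          by_contra h; exact hcon (e12 (not_lt.mp h))
        have g2 : 0 < (a-1)*(b*x)+(c-1)*t := by
          by_contra h; exact hcon (by linarith [e32 (not_lt.mp h)])
        have g3 : 0 < (b-c)*(a*x)+(1-c)*(z+s) := by
          by_contra h; exact hcon (by linarith [e42 (not_lt.mp h)])
        -- (1-a) z > (b-c) t, (c-1) t > (1-a) b x, (b-c) a x > (c-1)(z+s)
        have k0 : 0 ≤ (c-1)*s := P (by linarith) hs
        have k1 : (1-a)*((c-1)*z) ≤ (1-a)*((b-c)*(a*x)) :=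
          mul_le_mul_of_nonneg_left (by linarith) (by linarith)
        have k2 : (b-c)*((1-a)*(b*x)) ≤ (b-c)*((c-1)*t) :=
          mul_le_mul_of_nonneg_left (by linarith) (by linarith)
        have hc1 : 0 < c - 1 := by
          rcases h2.lt_or_eq with h | h
          · linarith
          · subst h
            have := N (show a - 1 ≤ 0 by linarith) hbx
            linarith
        have k3 : (c-1)*((b-c)*t) < (c-1)*((1-a)*z) :=
          mul_lt_mul_of_pos_left (by linarith) hc1
        have k4 : 0 ≤ (b-c)*(1-a)*((b-a)*x) :=
          P (P (by linarith) (by linarith)) (P (by linarith) hx)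
        nlinarith
      refine ⟨?_, ?_, ?_, ?_⟩ <;> linarith
  · -- c ≤ 1 ≤ a
    have f1 := e15 (PP (P (by linarith) hz) (P (by linarith) ht))
    have f2 := e52 (N (by linarith) ht)
    have f3 := e24 (PP (P (by linarith) hax) (P (by linarith) hzs))
    have f6 := e53 (P (by linarith) hbx)
    rcases le_total b a with h3 | h3
    · have f4 := e43 (NN (N (by linarith) hx) (N (by linarith) hy))
      have f5 := e31 (NN (N (by linarith) hcys) (N (by linarith) ht))
      refine ⟨?_, ?_, ?_, ?_⟩ <;> linarith
    · have f5 := e41 (NN (NN (N (by linarith) hy) (N (by linarith) hz)) (N (by linarith) hs))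
      have f7 : r3 ≤ r4 ∨ r3 ≤ r5 := by
        by_cases hc1 : c = 1
        · left; exact e34 (PP (P (by linarith) hx) (P (by linarith) hy))
        · have hc2 : c < 1 := lt_of_le_of_ne h2 hc1
          by_cases ha1 : a = 1
          · right; exact e35 (N (by linarith) hbx)
          · have ha2 : 1 < a := lt_of_le_of_ne h1 (Ne.symm ha1)
            have hba : a = b := le_antisymm h3 (by
              by_contra h; exact hY ⟨hc2, ha2, not_le.mp h⟩)
            have g1 := e31 (NN (N (by linarith) hcys) (N (by linarith) ht))
            right; linarith
      rcases f7 with f7 | f7 <;> refine ⟨?_, ?_, ?_, ?_⟩ <;> linarith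
  · -- 1 ≤ a, 1 ≤ c
    have f1 := e15 (PP (P (by linarith) hz) (P (by linarith) ht))
    have f2 := e25 (P (by linarith) ht)
    have f3 := e53 (P (by linarith) hbx)
    have f4 := e54 (PP (P (by linarith) hax) (P (by linarith) hy))
    rcases le_total b a with h3 | h3 <;> rcases le_total b c with h4 | h4
    · have f5 := e42 (NN (N (by linarith) hax) (N (by linarith) hzs))
      have f6 := e31 (NN (N (by linarith) hcys) (N (by linarith) ht))
      refine ⟨?_, ?_, ?_, ?_⟩ <;> linarith
    · -- c ≤ b ≤ a
      have f5 := e12 (PP (P (by linarith) hz) (P (by linarith) ht))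
      have f6 := e31 (NN (N (by linarith) hcys) (N (by linarith) ht))
      have f7 : r4 ≤ r1 := by
        by_cases hc1 : c = 1
        · have := e43 (NN (N (by linarith) hx) (N (by linarith) hy))
          linarith
        · have hc2 : 1 < c := lt_of_le_of_ne h2 (Ne.symm hc1)
          by_cases hcb : c = b
          · have g1 := e42 (NN (N (by linarith) hax) (N (by linarith) hzs))
            linarith
          · have hba : a ≤ b := by
              by_contra h; exact hX ⟨hc2, lt_of_le_of_ne h4 hcb, not_le.mp h⟩
            exact e41 (NN (NN (N (by linarith) hy) (N (by linarith) hz)) (N (by linarith) hs))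
      refine ⟨?_, ?_, ?_, ?_⟩ <;> linarith
    · -- a ≤ b ≤ c
      have f5 := e34 (PP (P (by linarith) hx) (P (by linarith) hy))
      have f6 := e42 (NN (N (by linarith) hax) (N (by linarith) hzs))
      have f7 : r2 ≤ r1 := by
        by_contra hcon
        have g1 : 0 < (a-1)*z+(b-c)*t := by
          by_contra h; exact hcon (e21 (not_lt.mp h))
        have g2 : 0 < (1-a)*(c*y+s)+(b-a)*t := by
          by_contra h; exact hcon (by linarith [e31 (not_lt.mp h)])
        have g3 : 0 < (c-b)*y+(a-b)*z+(1-b)*s := by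
          by_contra h; exact hcon (by linarith [e41 (not_lt.mp h)])
        have ha1 : 0 < a - 1 := by
          rcases h1.lt_or_eq with h | h
          · linarith
          · subst h
            have := P (show 0 ≤ c - b by linarith) ht
            linarith
        have k0 : 0 ≤ (a-1)*s := P (by linarith) hs
        have k0' : 0 ≤ (b-1)*s := P (by linarith) hs
        have k1 : (b-a)*((c-b)*t) ≤ (b-a)*((a-1)*z) :=
          mul_le_mul_of_nonneg_left (by linarith) (by linarith)
        have k2 : (c-b)*((a-1)*(c*y)) ≤ (c-b)*((b-a)*t) :=
          mul_le_mul_of_nonneg_left (by linarith) (by linarith)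
        have k3 : (a-1)*((b-a)*z) < (a-1)*((c-b)*y) :=
          mul_lt_mul_of_pos_left (by linarith) ha1
        have k4 : 0 ≤ (c-b)*(a-1)*((c-1)*y) :=
          P (P (by linarith) (by linarith)) (P (by linarith) hy)
        nlinarith
      refine ⟨?_, ?_, ?_, ?_⟩ <;> linarith
    · have f5 := e12 (PP (P (by linarith) hz) (P (by linarith) ht))
      have f6 := e34 (PP (P (by linarith) hx) (P (by linarith) hy))
      have f7 := e41 (NN (NN (N (by linarith) hy) (N (by linarith) hz)) (N (by linarith) hs))
      refine ⟨?_, ?_, ?_, ?_⟩ <;> linarith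

lemma exists_between_four {w p q r s : ℝ} (h1 : w < p) (h2 : w < q) (h3 : w < r) (h4 : w < s) :
    ∃ x, w < x ∧ x ≤ p ∧ x ≤ q ∧ x ≤ r ∧ x ≤ s :=
  ⟨min (min p q) (min r s), by simp [*], by simp, by simp, by simp, by simp⟩

/-- Theorem tmain5by5: characterization. -/
theorem coneCols_subset_effSet_five_iff (a13 a14 a24 : ℝ)
    (h13 : 0 < a13) (h24 : 0 < a24) (h14 : 1 ≤ a14) :
    (ConeCols !![1, 1, a13, a14, 1; 1, 1, 1, a24, 1; 1 / a13, 1, 1, 1, 1; 1 / a14, 1 / a24, 1, 1, 1; 1, 1, 1, 1, 1] ⊆ EffSet !![1, 1, a13, a14, 1; 1, 1, 1, a24, 1; 1 / a13, 1, 1, 1, 1; 1 / a14, 1 / a24, 1, 1, 1; 1, 1, 1, 1, 1]) ↔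
      (¬ (1 < a24 ∧ a24 < a14 ∧ a14 < a13) ∧ ¬ (a24 < 1 ∧ 1 < a13 ∧ a13 < a14)) := by
  have hb0 : 0 < a14 := by linarith
  set A : Matrix (Fin 5) (Fin 5) ℝ := !![1, 1, a13, a14, 1; 1, 1, 1, a24, 1; 1 / a13, 1, 1, 1, 1; 1 / a14, 1 / a24, 1, 1, 1; 1, 1, 1, 1, 1] with hAdef
  have hApos : ∀ i j, 0 < A i j := by
    intro i j
    fin_cases i <;> fin_cases j <;> simp [A] <;> assumption
  have hArec : ∀ i j, A i j = 1 / A j i := by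
    intro i j
    fin_cases i <;> fin_cases j <;> simp [A]
  have hmul : ∀ x y z t s : ℝ, A.mulVec ![a13*a14*x, a24*y, z, t, s] =
      ![a13*a14*x + a24*y + a13*z + a14*t + s, a13*a14*x + a24*y + z + a24*t + s,
        a14*x + a24*y + z + t + s, a13*x + y + z + t + s, a13*a14*x + a24*y + z + t + s] := by
    intro x y z t s
    ext i
    fin_cases i <;> simp [A, Matrix.mulVec, dotProduct, Fin.sum_univ_five] <;> field_simp
  have hwpos : ∀ u : Fin 5 → ℝ, (∀ i, 0 ≤ u i) → A.mulVec u ≠ 0 → ∀ i, 0 < A.mulVec u i := by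
    intro u hu hne i
    have : ∃ j, 0 < u j := by
      by_contra h
      push Not at h
      have : u = 0 := funext fun j => le_antisymm (h j) (hu j)
      subst this
      exact hne (by simp)
    obtain ⟨j, hj⟩ := this
    exact Finset.sum_pos' (fun k _ => mul_nonneg (hApos i k).le (hu k))
      ⟨j, Finset.mem_univ _, mul_pos (hApos i j) hj⟩
  constructor
  · intro hsub
    -- refutation scheme
    have key : ∀ x y z t : ℝ, 0 ≤ x → 0 < y → 0 ≤ z → 0 ≤ t → ∀ k l : Fin 5, l ≠ k →
        ∀ X : ℝ, A.mulVec ![a13*a14*x, a24*y, z, t, 0] k < X →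
        (∀ j, j ≠ k → A j k * X ≤ A.mulVec ![a13*a14*x, a24*y, z, t, 0] j) → False := by
      intro x y z t hx hy hz ht k l hlk X hX hj
      have hu : ∀ i, 0 ≤ (![a13*a14*x, a24*y, z, t, 0] : Fin 5 → ℝ) i := by
        intro i
        fin_cases i <;> simp <;> first | assumption | positivity
      have hne : A.mulVec ![a13*a14*x, a24*y, z, t, 0] ≠ 0 := by
        intro h
        have h4 := congrFun h 4
        rw [hmul] at h4
        simp at h4
        have : 0 < a13*a14*x + a24*y + z + t := by positivity
        linarith
      exact not_efficient_of_sink A _ k l hlk (fun j => hApos j k) (fun j => hArec k j)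
        (hwpos _ hu hne) X hX hj (hsub ⟨hne, _, hu, rfl⟩)
    constructor
    · rintro ⟨h1, h2, h3⟩
      have ha : 1 < a13 := by linarith
      obtain ⟨q, hq1, hq2⟩ := exists_between ha
      obtain ⟨r, hr1, hr2⟩ := exists_between hq2
      -- x = c-1, y = (a-b) q, z = (b-c) r
      have p1 : 0 < a24 - 1 := by linarith
      have p2 : 0 < a13 - a14 := by linarith
      have p3 : 0 < a14 - a24 := by linarith
      have m1 := mul_pos (mul_pos p1 p2) (sub_pos.2 hq1)
      have m2 := mul_pos (mul_pos p2 p3) (sub_pos.2 hr1)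
      have m3 := mul_pos (mul_pos p1 p3) (sub_pos.2 hr2)
      have m4 := mul_pos (mul_pos p1 p2) (show 0 < q by linarith)
      have m5 := mul_pos (mul_pos h13 p1) (show 0 < a14 - 1 by linarith)
      obtain ⟨X, hX, x0, x1, x2, x4⟩ := exists_between_four
        (w := a13*(a24-1) + (a13-a14)*q + (a14-a24)*r)
        (p := (a13*a14*(a24-1) + a24*((a13-a14)*q) + a13*((a14-a24)*r))/a14)
        (q := (a13*a14*(a24-1) + a24*((a13-a14)*q) + (a14-a24)*r)/a24)
        (r := a14*(a24-1) + a24*((a13-a14)*q) + (a14-a24)*r)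
        (s := a13*a14*(a24-1) + a24*((a13-a14)*q) + (a14-a24)*r)
        (by rw [lt_div_iff₀ hb0]; nlinarith) (by rw [lt_div_iff₀ h24]; nlinarith)
        (by nlinarith) (by nlinarith)
      rw [le_div_iff₀ hb0] at x0
      rw [le_div_iff₀ h24] at x1
      refine key (a24-1) ((a13-a14)*q) ((a14-a24)*r) 0 p1.le (mul_pos p2 (by linarith))
        (mul_pos p3 (by linarith)).le le_rfl 3 0 (by decide) X ?_ ?_
      · rw [hmul]; simp; linarith
      · intro j hj
        rw [hmul]
        fin_cases j <;> simp [A] at hj ⊢ <;> linarith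
    · rintro ⟨h1, h2, h3⟩
      have hb1 : 1 < a14 := by linarith
      obtain ⟨r, hr1, hr2⟩ := exists_between hb1
      -- b x = (1-c) r, y = (b-a), t = a-1
      have p1 : 0 < 1 - a24 := by linarith
      have p2 : 0 < a14 - a13 := by linarith
      have p3 : 0 < a13 - 1 := by linarith
      have m1 := mul_pos (mul_pos p1 p2) p3
      have m2 := mul_pos (mul_pos p1 p2) (sub_pos.2 hr2)
      have m3 := mul_pos (mul_pos p1 p3) (sub_pos.2 hr1)
      have m4 := mul_pos p2 p3
      have m5 := mul_pos p1 p2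
      have m6 := mul_pos p1 p3
      have hr0 : 0 < r := by linarith
      have m7 := mul_pos (mul_pos p1 p3) hr0
      have hx : 0 < (1-a24)*r/a14 := by positivity
      set x := (1-a24)*r/a14 with hxdef
      have hbx : a14 * x = (1-a24)*r := by rw [hxdef]; field_simp
      have habx : a13 * a14 * x = a13*((1-a24)*r) := by rw [mul_assoc, hbx]
      have hs34 : a14 * x + a24*(a14-a13) < a13*x + (a14-a13) := by
        have : a14 * (a14 * x + a24*(a14-a13)) < a14 * (a13*x + (a14-a13)) := by
          have e : a14 * (a13 * x) = a13*((1-a24)*r) := by rw [← habx]; ring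
          rw [mul_add, mul_add, e, hbx]
          nlinarith
        exact lt_of_mul_lt_mul_left this hb0.le
      obtain ⟨X, hX, x0, x1, x3, x4⟩ := exists_between_four
        (w := a14*x + a24*(a14-a13) + (a13-1))
        (p := (a13*a14*x + a24*(a14-a13) + a14*(a13-1))/a13)
        (q := a13*a14*x + a24*(a14-a13) + a24*(a13-1))
        (r := a13*x + (a14-a13) + (a13-1))
        (s := a13*a14*x + a24*(a14-a13) + (a13-1))
        (by rw [lt_div_iff₀ h13, habx, hbx]; nlinarith) (by rw [habx, hbx]; nlinarith)
        (by linarith) (by rw [habx, hbx]; nlinarith)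
      rw [le_div_iff₀ h13] at x0
      refine key x (a14-a13) 0 (a13-1) hx.le p2 le_rfl p3.le 2 0 (by decide) X ?_ ?_
      · rw [hmul]; simp; linarith
      · intro j hj
        rw [hmul]
        fin_cases j <;> simp [A] at hj ⊢ <;> linarith
  · rintro ⟨hX, hY⟩ w ⟨hne, u, hu, rfl⟩
    have hw := hwpos u hu hne
    refine ⟨hw, fun v hv h => ?_⟩
    have hedge : ∀ i j, A i j * A.mulVec u j ≤ A.mulVec u i →
        v i / A.mulVec u i ≤ v j / A.mulVec u j := fun i j hij =>
      ratio_le_of_edge (hw i) (hw j) (hv j) (h i j) hij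
    have hx : 0 ≤ u 0 / (a13*a14) := div_nonneg (hu 0) (by positivity)
    have hy : 0 ≤ u 1 / a24 := div_nonneg (hu 1) h24.le
    have hueq : u = ![a13*a14*(u 0 / (a13*a14)), a24*(u 1 / a24), u 2, u 3, u 4] := by
      ext i
      fin_cases i <;> simp <;> field_simp
    have hW := hmul (u 0 / (a13*a14)) (u 1 / a24) (u 2) (u 3) (u 4)
    rw [← hueq] at hW
    generalize u 0 / (a13*a14) = x at *
    generalize u 1 / a24 = y at *
    have hz := hu 2
    have ht := hu 3
    have hs := hu 4
    generalize A.mulVec u = W at *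
    generalize u 2 = z at *
    generalize u 3 = t at *
    generalize u 4 = s at *
    have w0 : W 0 = a13*a14*x + a24*y + a13*z + a14*t + s := by rw [hW]; simp
    have w1 : W 1 = a13*a14*x + a24*y + z + a24*t + s := by rw [hW]; simp
    have w2 : W 2 = a14*x + a24*y + z + t + s := by rw [hW]; simp
    have w3 : W 3 = a13*x + y + z + t + s := by rw [hW]; simp
    have w4 : W 4 = a13*a14*x + a24*y + z + t + s := by rw [hW]; simp
    have hinv : ∀ {p q r : ℝ}, 0 < p → q ≤ p * r → 1 / p * q ≤ r := by
      intro p q r hp hq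
      rw [one_div, inv_mul_le_iff₀ hp]
      exact hq
    obtain ⟨q1, q2, q3, q4⟩ := core a13 a14 a24 x y z t s (v 0 / W 0) (v 1 / W 1) (v 2 / W 2)
      (v 3 / W 3) (v 4 / W 4) h13 h24 h14 hx hy hz ht hs
      (fun g => hedge 0 4 (by rw [show A 0 4 = 1 from rfl, w0, w4]; linarith))
      (fun g => hedge 1 4 (by rw [show A 1 4 = 1 from rfl, w1, w4]; linarith))
      (fun g => hedge 4 1 (by rw [show A 4 1 = 1 from rfl, w1, w4]; linarith))
      (fun g => hedge 4 2 (by rw [show A 4 2 = 1 from rfl, w2, w4]; linarith))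
      (fun g => hedge 2 4 (by rw [show A 2 4 = 1 from rfl, w2, w4]; linarith))
      (fun g => hedge 4 3 (by rw [show A 4 3 = 1 from rfl, w3, w4]; linarith))
      (fun g => hedge 0 1 (by rw [show A 0 1 = 1 from rfl, w0, w1]; linarith))
      (fun g => hedge 1 0 (by rw [show A 1 0 = 1 from rfl, w0, w1]; linarith))
      (fun g => hedge 2 1 (by rw [show A 2 1 = 1 from rfl, w1, w2]; linarith))
      (fun g => hedge 2 3 (by rw [show A 2 3 = 1 from rfl, w2, w3]; linarith))
      (fun g => hedge 3 2 (by rw [show A 3 2 = 1 from rfl, w2, w3]; linarith))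
      (fun g => hedge 0 2 (by rw [show A 0 2 = a13 from rfl, w0, w2]; linarith))
      (fun g => hedge 2 0 (by
        rw [show A 2 0 = 1 / a13 from rfl, w0, w2]; exact hinv h13 (by linarith)))
      (fun g => hedge 3 0 (by
        rw [show A 3 0 = 1 / a14 from rfl, w0, w3]; exact hinv hb0 (by linarith)))
      (fun g => hedge 1 3 (by rw [show A 1 3 = a24 from rfl, w1, w3]; linarith))
      (fun g => hedge 3 1 (by
        rw [show A 3 1 = 1 / a24 from rfl, w1, w3]; exact hinv h24 (by linarith)))
      hX hY
    refine ⟨v 0 / W 0, funext fun i => ?_⟩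
    have hi : v i / W i = v 0 / W 0 := by
      fin_cases i
      · rfl
      · exact q1
      · exact q2
      · exact q3
      · exact q4
    rw [Pi.smul_apply, smul_eq_mul, ← hi, div_mul_cancel₀ _ (hw i).ne']
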